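/- Let μ be a unit pure quaternion, A ∈ ℍ^{n₁×r×n₃}, and B ∈ ℍ^{r×n₂×n₃}. Then (A *_μ B)* = B* *_μ A*. -/

import Mathlib

noncomputable section
open Matrix Kronecker Filter Topology

namespace QTpaper

/-- The quaternion unit `i`. -/
def qi : Quaternion ℝ := ⟨0, 1, 0, 0⟩
/-- The quaternion unit `j`. -/
def qj : Quaternion ℝ := ⟨0, 0, 1, 0⟩
/-- The quaternion unit `k`. -/
def qk : Quaternion ℝ := ⟨0, 0, 0, 1⟩

/-- A unit pure quaternion: zero real part and norm one. -/
def UnitPure (μ : Quaternion ℝ) : Prop := μ.re = 0 ∧ ‖μ‖ = 1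

/-- Third-order quaternion tensors. -/
abbrev QTensor (a b c : ℕ) := Fin a → Fin b → Fin c → Quaternion ℝ

/-- `l`-th frontal slice of a third-order tensor. -/
def fslice {a b c : ℕ} (A : QTensor a b c) (l : Fin c) :
    Matrix (Fin a) (Fin b) (Quaternion ℝ) := fun p q => A p q l

/-- Frobenius norm of a quaternion matrix. -/
def frobM {m n : ℕ} (A : Matrix (Fin m) (Fin n) (Quaternion ℝ)) : ℝ :=
  Real.sqrt (∑ p, ∑ q, ‖A p q‖ ^ 2)

/-- Frobenius norm of a third-order quaternion tensor. -/
def frobT {a b c : ℕ} (A : QTensor a b c) : ℝ :=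
  Real.sqrt (∑ p, ∑ q, ∑ l, ‖A p q l‖ ^ 2)

/-- The normalized QDFT matrix `F_{μ,n}` with entries
`(1/√n)·ω^{(p-1)(q-1)}`, `ω^m = cos(2πm/n) − μ·sin(2πm/n)`. -/
def Fq (μ : Quaternion ℝ) (n : ℕ) : Matrix (Fin n) (Fin n) (Quaternion ℝ) :=
  fun p q =>
    ((1 / Real.sqrt n : ℝ) : Quaternion ℝ) *
      (((Real.cos (2 * Real.pi * (p.1 * q.1) / n) : ℝ) : Quaternion ℝ)
        - ((Real.sin (2 * Real.pi * (p.1 * q.1) / n) : ℝ) : Quaternion ℝ) * μ)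

/-- The permutation matrix `P_n` (1-based: `P₁₁ = 1`, `P_{pq} = 1` for `p+q = n+2`). -/
def Pmat (n : ℕ) : Matrix (Fin n) (Fin n) ℝ :=
  fun p q => if (p.1 = 0 ∧ q.1 = 0) ∨ (p.1 + q.1 = n) then 1 else 0

/-- Block circulant matrix of a third-order tensor. -/
def circ {a b c : ℕ} (A : QTensor a b c) :
    Matrix (Fin c × Fin a) (Fin c × Fin b) (Quaternion ℝ) :=
  fun pi qj => A pi.2 qj.2 (pi.1 - qj.1)

/-- `unfold` stacks the frontal slices vertically. -/
def unfold3 {a b c : ℕ} (A : QTensor a b c) :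
    Matrix (Fin c × Fin a) (Fin b) (Quaternion ℝ) :=
  fun pi q => A pi.2 q pi.1

/-- `fold` is the inverse of `unfold`. -/
def fold3 {a b c : ℕ} (M : Matrix (Fin c × Fin a) (Fin b) (Quaternion ℝ)) :
    QTensor a b c := fun p q l => M (l, p) q

/-- Block diagonal matrix whose `l`-th diagonal block is the `l`-th frontal slice. -/
def diagT {a b c : ℕ} (A : QTensor a b c) :
    Matrix (Fin c × Fin a) (Fin c × Fin b) (Quaternion ℝ) :=
  fun pi qj => if pi.1 = qj.1 then A pi.2 qj.2 pi.1 else 0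

/-- The QDFT along mode 3: `fft(A)(p,q,:) = √n₃ · F_{μ,n₃} · A(p,q,:)`. -/
def fftT {a b c : ℕ} (μ : Quaternion ℝ) (A : QTensor a b c) : QTensor a b c :=
  fun p q l => ((Real.sqrt c : ℝ) : Quaternion ℝ) * ∑ m, Fq μ c l m * A p q m

/-- Real-part component tensor. -/
def compE {a b c : ℕ} (A : QTensor a b c) : QTensor a b c :=
  fun p q l => (((A p q l).re : ℝ) : Quaternion ℝ)
/-- `i`-component tensor. -/
def compI {a b c : ℕ} (A : QTensor a b c) : QTensor a b c :=
  fun p q l => (((A p q l).imI : ℝ) : Quaternion ℝ)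
/-- `j`-component tensor. -/
def compJ {a b c : ℕ} (A : QTensor a b c) : QTensor a b c :=
  fun p q l => (((A p q l).imJ : ℝ) : Quaternion ℝ)
/-- `k`-component tensor. -/
def compK {a b c : ℕ} (A : QTensor a b c) : QTensor a b c :=
  fun p q l => (((A p q l).imK : ℝ) : Quaternion ℝ)

/-- For `μ = a·i + b·j + c·k`, `μ_i = a·i − b·j − c·k`. -/
def mui (μ : Quaternion ℝ) : Quaternion ℝ := ⟨0, μ.imI, -μ.imJ, -μ.imK⟩
/-- For `μ = a·i + b·j + c·k`, `μ_j = −a·i + b·j − c·k`. -/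
def muj (μ : Quaternion ℝ) : Quaternion ℝ := ⟨0, -μ.imI, μ.imJ, -μ.imK⟩
/-- For `μ = a·i + b·j + c·k`, `μ_k = −a·i − b·j + c·k`. -/
def muk (μ : Quaternion ℝ) : Quaternion ℝ := ⟨0, -μ.imI, -μ.imJ, μ.imK⟩

/-- `T` matrix `F_{ν,n}^* · F_{μ,n}`. -/
def Tm (ν μ : Quaternion ℝ) (n : ℕ) : Matrix (Fin n) (Fin n) (Quaternion ℝ) :=
  (Fq ν n)ᴴ * Fq μ n

/-- The gQt-product of third-order quaternion tensors. -/
def gQt {n₁ r n₂ n₃ : ℕ} (μ : Quaternion ℝ) (A : QTensor n₁ r n₃)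
    (B : QTensor r n₂ n₃) : QTensor n₁ n₂ n₃ :=
  fold3 ((circ (compE A)
      + qi • (circ (compI A) * (Tm (mui μ) μ n₃ ⊗ₖ (1 : Matrix (Fin r) (Fin r) (Quaternion ℝ))))
      + qj • (circ (compJ A) * (Tm (muj μ) μ n₃ ⊗ₖ (1 : Matrix (Fin r) (Fin r) (Quaternion ℝ))))
      + qk • (circ (compK A) * (Tm (muk μ) μ n₃ ⊗ₖ (1 : Matrix (Fin r) (Fin r) (Quaternion ℝ)))))
    * unfold3 B)

/-- The index reversal `1 ↦ 1`, `l ↦ n₃ + 2 − l` (1-based), used in the tensor transpose. -/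
def revIdx {c : ℕ} (l : Fin c) : Fin c :=
  if h : l.1 = 0 then l else ⟨c - l.1, by have := l.2; omega⟩

/-- Transpose of a (componentwise real) tensor: transpose each frontal slice and
reverse the order of the transposed slices `2` through `n₃`. -/
def transT {a b c : ℕ} (A : QTensor a b c) : QTensor b a c :=
  fun q p l => A p q (revIdx l)

/-- Right multiplication of a matrix by a quaternion scalar. -/
def rmulM {m n : Type*} (M : Matrix m n (Quaternion ℝ)) (x : Quaternion ℝ) :
    Matrix m n (Quaternion ℝ) := fun p q => M p q * x

/-- Conjugate transpose of a third-order quaternion tensor. -/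
def conjT {n₁ n₂ n₃ : ℕ} (μ : Quaternion ℝ) (A : QTensor n₁ n₂ n₃) : QTensor n₂ n₁ n₃ :=
  fold3 (unfold3 (transT (compE A))
    - rmulM (((Tm (mui μ) μ n₃)ᴴ ⊗ₖ (1 : Matrix (Fin n₂) (Fin n₂) (Quaternion ℝ)))
        * unfold3 (transT (compI A))) qi
    - rmulM (((Tm (muj μ) μ n₃)ᴴ ⊗ₖ (1 : Matrix (Fin n₂) (Fin n₂) (Quaternion ℝ)))
        * unfold3 (transT (compJ A))) qj
    - rmulM (((Tm (muk μ) μ n₃)ᴴ ⊗ₖ (1 : Matrix (Fin n₂) (Fin n₂) (Quaternion ℝ)))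
        * unfold3 (transT (compK A))) qk)

/-- The identity tensor: first frontal slice is the identity, the others vanish. -/
def idT (n l : ℕ) : QTensor n n l :=
  fun p q m => if m.1 = 0 ∧ p = q then 1 else 0

/-- Unitary tensor with respect to the gQt-product. -/
def unitaryT {n n₃ : ℕ} (μ : Quaternion ℝ) (U : QTensor n n n₃) : Prop :=
  gQt μ (conjT μ U) U = idT n n₃ ∧ gQt μ U (conjT μ U) = idT n n₃

/-- f-diagonal tensor: each frontal slice is a diagonal matrix. -/
def fDiag {a b c : ℕ} (S : QTensor a b c) : Prop :=
  ∀ p q l, p.1 ≠ q.1 → S p q l = 0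

lemma UnitPure.mul_self {μ : Quaternion ℝ} (hμ : UnitPure μ) : μ * μ = -1 := by
  have h1 := Quaternion.normSq_eq_norm_mul_self μ
  rw [hμ.2, Quaternion.normSq_def'] at h1
  have h0 := hμ.1
  have h1' : μ.imI ^ 2 + μ.imJ ^ 2 + μ.imK ^ 2 = 1 := by simpa [h0] using h1
  ext
  · rw [Quaternion.re_mul, Quaternion.re_neg, Quaternion.re_one, h0]
    linarith
  · rw [Quaternion.imI_mul, Quaternion.imI_neg, Quaternion.imI_one, h0]
    ring
  · rw [Quaternion.imJ_mul, Quaternion.imJ_neg, Quaternion.imJ_one, h0]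
    ring
  · rw [Quaternion.imK_mul, Quaternion.imK_neg, Quaternion.imK_one, h0]
    ring

lemma UnitPure.star_eq {μ : Quaternion ℝ} (hμ : UnitPure μ) : star μ = -μ := by
  ext <;> simp [hμ.1]

/-- The real algebra embedding `ℂ → ℍ` sending `I` to `-μ`. -/
def complexEmb {μ : Quaternion ℝ} (hμ : UnitPure μ) : ℂ →ₐ[ℝ] Quaternion ℝ :=
  Complex.lift ⟨-μ, by rw [neg_mul_neg, hμ.mul_self]⟩

lemma complexEmb_apply {μ : Quaternion ℝ} (hμ : UnitPure μ) (z : ℂ) :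
    complexEmb hμ z = (z.re : Quaternion ℝ) - (z.im : Quaternion ℝ) * μ := by
  simp [complexEmb, Complex.lift_apply, Complex.liftAux_apply, sub_eq_add_neg,
    Quaternion.coe_mul_eq_smul]

lemma complexEmb_star {μ : Quaternion ℝ} (hμ : UnitPure μ) (z : ℂ) :
    complexEmb hμ (star z) = star (complexEmb hμ z) := by
  rw [complexEmb_apply, complexEmb_apply]
  simp [hμ.star_eq, (Quaternion.coe_commutes z.im μ).symm]

/-- The normalized complex DFT matrix with positive exponent. -/
def complexDFT (n : ℕ) : Matrix (Fin n) (Fin n) ℂ :=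
  fun p q => ((1 / Real.sqrt n : ℝ) : ℂ) * Complex.exp (2 * Real.pi * Complex.I / n) ^ (p.1 * q.1)

lemma Fq_apply_eq {μ : Quaternion ℝ} (hμ : UnitPure μ) (n : ℕ) (p q : Fin n) :
    Fq μ n p q = complexEmb hμ (complexDFT n p q) := by
  have h : Complex.exp (2 * Real.pi * Complex.I / n) ^ (p.1 * q.1)
      = Complex.exp (((2 * Real.pi * (p.1 * q.1) / n : ℝ) : ℂ) * Complex.I) := by
    rw [← Complex.exp_nat_mul]
    congr 1
    push_cast
    ring
  have h2 (x : ℝ) : complexEmb hμ (x : ℂ) = (x : Quaternion ℝ) := by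
    simp
  rw [complexDFT, map_mul, h, h2, complexEmb_apply, Complex.exp_ofReal_mul_I_re,
    Complex.exp_ofReal_mul_I_im, Fq]

lemma Fq_eq_map {μ : Quaternion ℝ} (hμ : UnitPure μ) (n : ℕ) :
    Fq μ n = (complexDFT n).map (complexEmb hμ) := by
  ext1 p q
  exact Fq_apply_eq hμ n p q

lemma star_exp_root (n : ℕ) :
    star (Complex.exp (2 * Real.pi * Complex.I / n))
      = (Complex.exp (2 * Real.pi * Complex.I / n))⁻¹ := by
  rw [← Complex.exp_neg, Complex.star_def, ← Complex.exp_conj]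
  congr 1
  simp only [map_div₀, map_mul, Complex.conj_ofReal, Complex.conj_I, map_natCast, map_ofNat]
  ring

lemma complexDFT_mul_conjTranspose (n : ℕ) [NeZero n] :
    complexDFT n * (complexDFT n)ᴴ = 1 := by
  have hn : n ≠ 0 := NeZero.ne n
  have hζ := Complex.isPrimitiveRoot_exp n hn
  have hs := star_exp_root n
  set ζ := Complex.exp (2 * Real.pi * Complex.I / n) with hζdef
  have hζ0 : ζ ≠ 0 := Complex.exp_ne_zero _
  have hc : ((1 / Real.sqrt n : ℝ) : ℂ) * ((1 / Real.sqrt n : ℝ) : ℂ) = (n : ℂ)⁻¹ := by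
    rw [← Complex.ofReal_mul, div_mul_div_comm, Real.mul_self_sqrt (Nat.cast_nonneg n)]
    simp
  ext l m
  have key (t : Fin n) : complexDFT n l t * (complexDFT n)ᴴ t m
      = (n : ℂ)⁻¹ * (ζ ^ l.1 * (ζ ^ m.1)⁻¹) ^ t.1 := by
    rw [Matrix.conjTranspose_apply, complexDFT, complexDFT, star_mul, ← hζdef, star_pow, hs,
      Complex.star_def, Complex.conj_ofReal, ← hc, mul_pow, pow_mul, inv_pow, inv_pow, pow_mul]
    ring
  rw [Matrix.mul_apply, Finset.sum_congr rfl fun t _ => key t, ← Finset.mul_sum,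
    Fin.sum_univ_eq_sum_range fun t => (ζ ^ l.1 * (ζ ^ m.1)⁻¹) ^ t]
  by_cases h : l = m
  · subst h
    simp [hζ0, hn]
  · have h1 : ζ ^ l.1 * (ζ ^ m.1)⁻¹ ≠ 1 := by
      intro h1
      rw [mul_inv_eq_one₀ (pow_ne_zero _ hζ0)] at h1
      exact h (Fin.ext (hζ.pow_inj l.2 m.2 h1))
    have h2 : (ζ ^ l.1 * (ζ ^ m.1)⁻¹) ^ n = 1 := by
      rw [mul_pow, inv_pow, ← pow_mul, ← pow_mul, mul_comm l.1, mul_comm m.1, pow_mul, pow_mul,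
        hζ.pow_eq_one]
      simp
    rw [geom_sum_eq h1, h2]
    simp [h]

lemma conjTranspose_Fq {μ : Quaternion ℝ} (hμ : UnitPure μ) (n : ℕ) :
    (Fq μ n)ᴴ = ((complexDFT n)ᴴ).map (complexEmb hμ) := by
  ext1 p q
  rw [Matrix.conjTranspose_apply, Fq_apply_eq hμ, ← complexEmb_star]
  rfl

lemma Fq_mul_conjTranspose {μ : Quaternion ℝ} (hμ : UnitPure μ) (n : ℕ) [NeZero n] :
    Fq μ n * (Fq μ n)ᴴ = 1 := by
  rw [conjTranspose_Fq hμ, Fq_eq_map hμ, ← Matrix.map_mul, complexDFT_mul_conjTranspose]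
  exact Matrix.map_one _ (map_zero _) (map_one _)

lemma conjTranspose_mul_Fq {μ : Quaternion ℝ} (hμ : UnitPure μ) (n : ℕ) [NeZero n] :
    (Fq μ n)ᴴ * Fq μ n = 1 := by
  rw [conjTranspose_Fq hμ, Fq_eq_map hμ, ← Matrix.map_mul,
    mul_eq_one_comm.mp (complexDFT_mul_conjTranspose n)]
  exact Matrix.map_one _ (map_zero _) (map_one _)

lemma complexDFT_add (n : ℕ) [NeZero n] (l s t : Fin n) :
    complexDFT n l (s + t) = (Real.sqrt n : ℂ) * (complexDFT n l s * complexDFT n l t) := by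
  have hn : n ≠ 0 := NeZero.ne n
  have hζ := Complex.isPrimitiveRoot_exp n hn
  have hs : (Real.sqrt n : ℂ) ≠ 0 := by
    rw [Ne, Complex.ofReal_eq_zero, Real.sqrt_eq_zero (Nat.cast_nonneg n)]
    exact_mod_cast hn
  unfold complexDFT
  set ζ := Complex.exp (2 * Real.pi * Complex.I / n)
  have h : ζ ^ (l.1 * (s + t).1) = ζ ^ (l.1 * s.1) * ζ ^ (l.1 * t.1) := by
    rw [← pow_add, ← mul_add, mul_comm, pow_mul, mul_comm l.1, pow_mul, Fin.val_add]
    congr 1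
    exact (pow_eq_pow_mod _ hζ.pow_eq_one).symm
  rw [h]
  push_cast
  field_simp

lemma Fq_add {μ : Quaternion ℝ} (hμ : UnitPure μ) (n : ℕ) [NeZero n] (l s t : Fin n) :
    Fq μ n l (s + t) = ((Real.sqrt n : ℝ) : Quaternion ℝ) * (Fq μ n l s * Fq μ n l t) := by
  simp only [Fq_apply_eq hμ, complexDFT_add, map_mul]
  congr 1
  simp

lemma revIdx_eq_neg {c : ℕ} [NeZero c] (l : Fin c) : revIdx l = -l := by
  ext
  rw [revIdx, Fin.val_neg']
  have := l.2
  split_ifs with h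
  · simp [h]
  · exact (Nat.mod_eq_of_lt (by omega)).symm

lemma Fq_neg {μ : Quaternion ℝ} (hμ : UnitPure μ) (n : ℕ) [NeZero n] (l t : Fin n) :
    Fq μ n l (-t) = star (Fq μ n l t) := by
  have hn : n ≠ 0 := NeZero.ne n
  have hζ := Complex.isPrimitiveRoot_exp n hn
  rw [Fq_apply_eq hμ, Fq_apply_eq hμ, ← complexEmb_star]
  congr 1
  unfold complexDFT
  rw [star_mul, star_pow, star_exp_root, Complex.star_def, Complex.conj_ofReal, mul_comm]
  congr 1
  set ζ := Complex.exp (2 * Real.pi * Complex.I / n)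
  rw [inv_pow]
  refine eq_inv_of_mul_eq_one_left ?_
  rw [← pow_add,
    ← mul_add, Fin.val_neg', mul_comm, pow_mul, pow_eq_pow_mod _ hζ.pow_eq_one, Nat.mod_add_mod,
    Nat.sub_add_cancel t.2.le]
  simp

/-- The circulant matrix of a real vector, as a quaternion matrix. -/
def realCirc {c : ℕ} (x : Fin c → ℝ) : Matrix (Fin c) (Fin c) (Quaternion ℝ) :=
  fun l t => (x (l - t) : Quaternion ℝ)

/-- A real vector viewed as a quaternion vector. -/
def realVec {c : ℕ} (x : Fin c → ℝ) : Fin c → Quaternion ℝ := fun l => (x l : Quaternion ℝ)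

/-- The convolution theorem for the QDFT of a real vector. -/
lemma Fq_mul_realCirc_apply {μ : Quaternion ℝ} (hμ : UnitPure μ) {c : ℕ} [NeZero c]
    (x : Fin c → ℝ) (l t : Fin c) :
    (Fq μ c * realCirc x) l t
      = ((Real.sqrt c : ℝ) : Quaternion ℝ) * ((Fq μ c *ᵥ realVec x) l * Fq μ c l t) := by
  rw [Matrix.mul_apply, ← Equiv.sum_comp (Equiv.addRight t), Matrix.mulVec, dotProduct,
    Finset.sum_mul, Finset.mul_sum]
  refine Finset.sum_congr rfl fun s _ => ?_
  simp only [Equiv.coe_addRight, realCirc, realVec, Fq_add hμ, add_sub_cancel_right]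
  rw [mul_assoc, mul_assoc, mul_assoc, Quaternion.coe_commutes (x s)]

lemma Fq_mulVec_realCirc_mulVec {μ : Quaternion ℝ} (hμ : UnitPure μ) {c : ℕ} [NeZero c]
    (x : Fin c → ℝ) (v : Fin c → Quaternion ℝ) (l : Fin c) :
    (Fq μ c *ᵥ (realCirc x *ᵥ v)) l
      = ((Real.sqrt c : ℝ) : Quaternion ℝ) *
        ((Fq μ c *ᵥ realVec x) l * (Fq μ c *ᵥ v) l) := by
  rw [Matrix.mulVec_mulVec]
  simp only [Matrix.mulVec, dotProduct, Fq_mul_realCirc_apply hμ]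
  simp only [mul_assoc, Finset.mul_sum]

lemma Fq_mul_unit {μ ν e : Quaternion ℝ} (h : ν * e = e * μ) (n : ℕ) (p q : Fin n) :
    Fq ν n p q * e = e * Fq μ n p q := by
  have hc (x : ℝ) (y : Quaternion ℝ) : e * ((x : Quaternion ℝ) * y) = x * (e * y) := by
    rw [← mul_assoc, ← Quaternion.coe_commutes, mul_assoc]
  rw [Fq, Fq, hc, mul_sub e, hc, ← Quaternion.coe_commutes _ e, mul_assoc _ _ e, sub_mul,
    mul_assoc _ ν e, h]

lemma smul_Tm {μ ν e : Quaternion ℝ} (h : ν * e = e * μ) (he : star e = -e) (n : ℕ) :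
    e • Tm ν μ n = (Fq μ n)ᴴ * (e • Fq μ n) := by
  ext1 p q
  rw [Tm, Matrix.smul_apply, Matrix.mul_apply, Matrix.mul_apply, smul_eq_mul, Finset.mul_sum]
  refine Finset.sum_congr rfl fun t _ => ?_
  have := congrArg star (Fq_mul_unit h n t p)
  rw [star_mul, star_mul, he] at this
  rw [Matrix.conjTranspose_apply, Matrix.conjTranspose_apply, Matrix.smul_apply, smul_eq_mul,
    ← mul_assoc, ← mul_assoc]
  congr 1
  simpa using this

lemma Fq_mulVec_unit_circ {μ ν e : Quaternion ℝ} (hμ : UnitPure μ) (h : ν * e = e * μ)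
    (he : star e = -e) {c : ℕ} [NeZero c] (x : Fin c → ℝ) (v : Fin c → Quaternion ℝ)
    (l : Fin c) :
    (Fq μ c *ᵥ ((realCirc x * (e • Tm ν μ c)) *ᵥ v)) l
      = ((Real.sqrt c : ℝ) : Quaternion ℝ) *
        ((Fq μ c *ᵥ realVec x) l * e * (Fq μ c *ᵥ v) l) := by
  rw [← Matrix.mulVec_mulVec, Fq_mulVec_realCirc_mulVec hμ, smul_Tm h he, Matrix.mulVec_mulVec,
    ← Matrix.mul_assoc, Fq_mul_conjTranspose hμ, Matrix.one_mul, Matrix.smul_mulVec,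
    Pi.smul_apply, smul_eq_mul, mul_assoc]

lemma Fq_mulVec_realVec_neg {μ : Quaternion ℝ} (hμ : UnitPure μ) {c : ℕ} [NeZero c]
    (x : Fin c → ℝ) (l : Fin c) :
    (Fq μ c *ᵥ realVec fun t => x (revIdx t)) l = star ((Fq μ c *ᵥ realVec x) l) := by
  simp only [Matrix.mulVec, dotProduct, star_sum, revIdx_eq_neg]
  rw [← Equiv.sum_comp (Equiv.neg (Fin c))]
  simp [realVec, Fq_neg hμ, Quaternion.coe_commutes]

lemma Fq_mulVec_Tm_realVec {μ ν e : Quaternion ℝ} (hμ : UnitPure μ) (h : ν * e = e * μ)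
    {c : ℕ} [NeZero c] (x : Fin c → ℝ) (l : Fin c) :
    (Fq μ c *ᵥ fun t => ((Tm ν μ c)ᴴ *ᵥ realVec x) t * e) l
      = e * (Fq μ c *ᵥ realVec x) l := by
  have h1 : (Fq μ c *ᵥ fun t => ((Tm ν μ c)ᴴ *ᵥ realVec x) t * e) l
      = (Fq μ c *ᵥ ((Tm ν μ c)ᴴ *ᵥ realVec x)) l * e := by
    simp only [Matrix.mulVec, dotProduct, Finset.sum_mul, mul_assoc]
  rw [h1, Tm, Matrix.conjTranspose_mul, Matrix.conjTranspose_conjTranspose,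
    Matrix.mulVec_mulVec, ← Matrix.mul_assoc, Fq_mul_conjTranspose hμ, Matrix.one_mul]
  simp only [Matrix.mulVec, dotProduct, Finset.sum_mul, Finset.mul_sum, realVec]
  refine Finset.sum_congr rfl fun t _ => ?_
  rw [mul_assoc, Quaternion.coe_commutes, ← mul_assoc, Fq_mul_unit h, mul_assoc]

@[simp] lemma qi_re : qi.re = 0 := rfl
@[simp] lemma qi_imI : qi.imI = 1 := rfl
@[simp] lemma qi_imJ : qi.imJ = 0 := rfl
@[simp] lemma qi_imK : qi.imK = 0 := rfl
@[simp] lemma qj_re : qj.re = 0 := rfl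
@[simp] lemma qj_imI : qj.imI = 0 := rfl
@[simp] lemma qj_imJ : qj.imJ = 1 := rfl
@[simp] lemma qj_imK : qj.imK = 0 := rfl
@[simp] lemma qk_re : qk.re = 0 := rfl
@[simp] lemma qk_imI : qk.imI = 0 := rfl
@[simp] lemma qk_imJ : qk.imJ = 0 := rfl
@[simp] lemma qk_imK : qk.imK = 1 := rfl
@[simp] lemma mui_re (μ : Quaternion ℝ) : (mui μ).re = 0 := rfl
@[simp] lemma mui_imI (μ : Quaternion ℝ) : (mui μ).imI = μ.imI := rfl
@[simp] lemma mui_imJ (μ : Quaternion ℝ) : (mui μ).imJ = -μ.imJ := rfl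
@[simp] lemma mui_imK (μ : Quaternion ℝ) : (mui μ).imK = -μ.imK := rfl
@[simp] lemma muj_re (μ : Quaternion ℝ) : (muj μ).re = 0 := rfl
@[simp] lemma muj_imI (μ : Quaternion ℝ) : (muj μ).imI = -μ.imI := rfl
@[simp] lemma muj_imJ (μ : Quaternion ℝ) : (muj μ).imJ = μ.imJ := rfl
@[simp] lemma muj_imK (μ : Quaternion ℝ) : (muj μ).imK = -μ.imK := rfl
@[simp] lemma muk_re (μ : Quaternion ℝ) : (muk μ).re = 0 := rfl
@[simp] lemma muk_imI (μ : Quaternion ℝ) : (muk μ).imI = -μ.imI := rfl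
@[simp] lemma muk_imJ (μ : Quaternion ℝ) : (muk μ).imJ = -μ.imJ := rfl
@[simp] lemma muk_imK (μ : Quaternion ℝ) : (muk μ).imK = μ.imK := rfl

lemma mui_mul_qi {μ : Quaternion ℝ} (hμ : UnitPure μ) : mui μ * qi = qi * μ := by
  ext <;> simp [hμ.1]

lemma muj_mul_qj {μ : Quaternion ℝ} (hμ : UnitPure μ) : muj μ * qj = qj * μ := by
  ext <;> simp [hμ.1]

lemma muk_mul_qk {μ : Quaternion ℝ} (hμ : UnitPure μ) : muk μ * qk = qk * μ := by
  ext <;> simp [hμ.1]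

lemma star_qi : star qi = -qi := by
  ext <;> simp

lemma star_qj : star qj = -qj := by
  ext <;> simp

lemma star_qk : star qk = -qk := by
  ext <;> simp

lemma Fq_mulVec_eq_components (μ : Quaternion ℝ) {c : ℕ} (v : Fin c → Quaternion ℝ) (l : Fin c) :
    (Fq μ c *ᵥ v) l = (Fq μ c *ᵥ realVec fun t => (v t).re) l
      + (Fq μ c *ᵥ realVec fun t => (v t).imI) l * qi
      + (Fq μ c *ᵥ realVec fun t => (v t).imJ) l * qj
      + (Fq μ c *ᵥ realVec fun t => (v t).imK) l * qk := by
  simp only [Matrix.mulVec, dotProduct, Finset.sum_mul, ← Finset.sum_add_distrib, realVec,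
    mul_assoc, ← mul_add]
  refine Finset.sum_congr rfl fun t _ => ?_
  congr 1
  ext <;> simp

lemma conjT_apply_eq (μ : Quaternion ℝ) {a b c : ℕ} (A : QTensor a b c) (p : Fin a) (q : Fin b) :
    conjT μ A q p = (realVec fun t => (A p q (revIdx t)).re)
      - (fun t => ((Tm (mui μ) μ c)ᴴ *ᵥ realVec fun t => (A p q (revIdx t)).imI) t * qi)
      - (fun t => ((Tm (muj μ) μ c)ᴴ *ᵥ realVec fun t => (A p q (revIdx t)).imJ) t * qj)
      - (fun t => ((Tm (muk μ) μ c)ᴴ *ᵥ realVec fun t => (A p q (revIdx t)).imK) t * qk) := by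
  funext l
  simp [conjT, fold3, unfold3, transT, rmulM, Matrix.mul_apply, Fintype.sum_prod_type,
    Matrix.mulVec, dotProduct, realVec, compE, compI, compJ, compK, Matrix.one_apply]

/-- The QDFT turns the conjugate transpose into the slicewise conjugate transpose. -/
lemma Fq_mulVec_conjT {μ : Quaternion ℝ} (hμ : UnitPure μ) {a b c : ℕ} [NeZero c]
    (A : QTensor a b c) (p : Fin a) (q : Fin b) (l : Fin c) :
    (Fq μ c *ᵥ conjT μ A q p) l = star ((Fq μ c *ᵥ A p q) l) := by
  rw [conjT_apply_eq, Matrix.mulVec_sub, Matrix.mulVec_sub, Matrix.mulVec_sub, Pi.sub_apply,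
    Pi.sub_apply, Pi.sub_apply, Fq_mulVec_Tm_realVec hμ (mui_mul_qi hμ),
    Fq_mulVec_Tm_realVec hμ (muj_mul_qj hμ), Fq_mulVec_Tm_realVec hμ (muk_mul_qk hμ),
    Fq_mulVec_eq_components μ (A p q)]
  simp only [star_add, star_mul, star_qi, star_qj, star_qk,
    Fq_mulVec_realVec_neg hμ fun t => (A p q t).re, Fq_mulVec_realVec_neg hμ fun t => (A p q t).imI,
    Fq_mulVec_realVec_neg hμ fun t => (A p q t).imJ,
    Fq_mulVec_realVec_neg hμ fun t => (A p q t).imK]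
  noncomm_ring

lemma smul_circ_mul_apply {a b c : ℕ} (e : Quaternion ℝ) (x : Fin a → Fin b → Fin c → ℝ)
    (T : Matrix (Fin c) (Fin c) (Quaternion ℝ)) (l m : Fin c) (p : Fin a) (s : Fin b) :
    (e • (circ (fun p q l => (x p q l : Quaternion ℝ))
      * (T ⊗ₖ (1 : Matrix (Fin b) (Fin b) (Quaternion ℝ))))) (l, p) (m, s)
      = (realCirc (x p s) * (e • T)) l m := by
  simp only [Matrix.smul_apply, Matrix.mul_apply, Fintype.sum_prod_type, circ, realCirc,
    Matrix.kroneckerMap_apply, Matrix.one_apply, smul_eq_mul, Finset.mul_sum]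
  refine Finset.sum_congr rfl fun t _ => ?_
  simp [mul_assoc, Quaternion.coe_commutes]

lemma gQt_apply_eq (μ : Quaternion ℝ) {a r b c : ℕ} (A : QTensor a r c) (B : QTensor r b c)
    (p : Fin a) (q : Fin b) :
    gQt μ A B p q = ∑ s, (realCirc (fun t => (A p s t).re) *ᵥ B s q
      + (realCirc (fun t => (A p s t).imI) * (qi • Tm (mui μ) μ c)) *ᵥ B s q
      + (realCirc (fun t => (A p s t).imJ) * (qj • Tm (muj μ) μ c)) *ᵥ B s q
      + (realCirc (fun t => (A p s t).imK) * (qk • Tm (muk μ) μ c)) *ᵥ B s q) := by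
  funext l
  simp only [← Matrix.add_mulVec, gQt, fold3, Finset.sum_apply]
  rw [Matrix.mul_apply, Fintype.sum_prod_type, Finset.sum_comm]
  refine Finset.sum_congr rfl fun s _ => ?_
  rw [Matrix.mulVec, dotProduct]
  refine Finset.sum_congr rfl fun m _ => ?_
  simp only [Matrix.add_apply]
  unfold compI compJ compK
  rw [smul_circ_mul_apply qi fun p q l => (A p q l).imI,
    smul_circ_mul_apply qj fun p q l => (A p q l).imJ,
    smul_circ_mul_apply qk fun p q l => (A p q l).imK]
  rfl

/-- The QDFT turns the gQt-product into the slicewise matrix product. -/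
lemma Fq_mulVec_gQt {μ : Quaternion ℝ} (hμ : UnitPure μ) {a r b c : ℕ} [NeZero c]
    (A : QTensor a r c) (B : QTensor r b c) (p : Fin a) (q : Fin b) (l : Fin c) :
    (Fq μ c *ᵥ gQt μ A B p q) l = ((Real.sqrt c : ℝ) : Quaternion ℝ) *
      ∑ s, (Fq μ c *ᵥ A p s) l * (Fq μ c *ᵥ B s q) l := by
  rw [gQt_apply_eq, Matrix.mulVec_sum, Finset.sum_apply, Finset.mul_sum]
  refine Finset.sum_congr rfl fun s _ => ?_
  rw [Matrix.mulVec_add, Matrix.mulVec_add, Matrix.mulVec_add, Pi.add_apply, Pi.add_apply,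
    Pi.add_apply, Fq_mulVec_realCirc_mulVec hμ, Fq_mulVec_unit_circ hμ (mui_mul_qi hμ) star_qi,
    Fq_mulVec_unit_circ hμ (muj_mul_qj hμ) star_qj,
    Fq_mulVec_unit_circ hμ (muk_mul_qk hμ) star_qk, Fq_mulVec_eq_components μ (A p s)]
  simp only [add_mul, mul_add]

lemma Fq_mulVec_injective {μ : Quaternion ℝ} (hμ : UnitPure μ) (c : ℕ) [NeZero c] :
    Function.Injective (Fq μ c *ᵥ ·) := by
  intro v w h
  have := congrArg ((Fq μ c)ᴴ *ᵥ ·) h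
  simpa [Matrix.mulVec_mulVec, conjTranspose_mul_Fq hμ] using this

/-- the conjugate transpose reverses gQt-products. -/
theorem conjT_gQt {n₁ r n₂ n₃ : ℕ} (μ : Quaternion ℝ) (hμ : UnitPure μ)
    (A : QTensor n₁ r n₃) (B : QTensor r n₂ n₃) :
    conjT μ (gQt μ A B) = gQt μ (conjT μ B) (conjT μ A) := by
  rcases Nat.eq_zero_or_pos n₃ with rfl | h
  · funext p q l
    exact l.elim0
  have : NeZero n₃ := ⟨h.ne'⟩
  funext q p
  refine Fq_mulVec_injective hμ n₃ (funext fun l => ?_)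
  simp only [Fq_mulVec_conjT hμ, Fq_mulVec_gQt hμ, star_mul, star_sum, Quaternion.star_coe,
    Quaternion.coe_commutes]

end QTpaper
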